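/- arXiv:math/0402272 — 2 statements merged into one kernel-verified Lean document; each statement's English description precedes it below -/
import Mathlib

section
/- Let V be a real vector space, let m ≥ 1, and let S_1, …, S_m be linear endomorphisms of V such that for every t = (t_1, …, t_m) ∈ ℝ^m with t_1² + ⋯ + t_m² = 1 the endomorphism S = t_1 S_1 + ⋯ + t_m S_m satisfies S³ = S. Then: (i) S_a³ = S_a for every a; (ii) S_a ∘ S_a ∘ S_b + S_a ∘ S_b ∘ S_a + S_b ∘ S_a ∘ S_a = S_b for all a ≠ b; and (iii) for all pairwise distinct a, b, c, the sum of the six products S_i ∘ S_j ∘ S_k taken over all orderings (i, j, k) of (a, b, c) is zero. -/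
section CubicExpansion

variable {R : Type*} [Ring R] [Algebra ℝ R]

theorem smul_add_smul_add_smul_pow_three (x y z : ℝ) (A B C : R) :
    (x • A + y • B + z • C) ^ 3 =
      x ^ 3 • A ^ 3 + y ^ 3 • B ^ 3 + z ^ 3 • C ^ 3 +
      (x ^ 2 * y) • (A * A * B + A * B * A + B * A * A) +
      (x ^ 2 * z) • (A * A * C + A * C * A + C * A * A) +
      (y ^ 2 * x) • (B * B * A + B * A * B + A * B * B) +
      (y ^ 2 * z) • (B * B * C + B * C * B + C * B * B) +
      (z ^ 2 * x) • (C * C * A + C * A * C + A * C * C) +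
      (z ^ 2 * y) • (C * C * B + C * B * C + B * C * C) +
      (x * y * z) • (A * B * C + A * C * B + B * A * C +
        B * C * A + C * A * B + C * B * A) := by
  simp only [pow_three, add_mul, mul_add, smul_mul_assoc, mul_smul_comm, mul_assoc]
  module

theorem smul_add_smul_pow_three (x y : ℝ) (A B : R) :
    (x • A + y • B) ^ 3 =
      x ^ 3 • A ^ 3 + y ^ 3 • B ^ 3 +
      (x ^ 2 * y) • (A * A * B + A * B * A + B * A * A) +
      (y ^ 2 * x) • (B * B * A + B * A * B + A * B * B) := by
  simpa using smul_add_smul_add_smul_pow_three x y 0 A B 0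

/-- If all unit combinations of `A` and `B` are tripotent, the part of bidegree `(2, 1)`
of the cube reduces to `B`. -/
theorem polarized_cube_eq_of_unit_pair {A B : R} (hA : A ^ 3 = A) (hB : B ^ 3 = B)
    (h : ∀ x y : ℝ, x ^ 2 + y ^ 2 = 1 → (x • A + y • B) ^ 3 = x • A + y • B) :
    A * A * B + A * B * A + B * A * A = B := by
  have h₁ := h (3 / 5) (4 / 5) (by norm_num)
  have h₂ := h (3 / 5) (-(4 / 5)) (by norm_num)
  rw [smul_add_smul_pow_three, hA, hB] at h₁ h₂
  linear_combination (norm := module) (125 / 72 : ℝ) • h₁ - (125 / 72 : ℝ) • h₂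

end CubicExpansion

theorem Fintype.sum_eq_add_add {ι M : Type*} [Fintype ι] [AddCommMonoid M]
    {f : ι → M} (a b c : ι) (hab : a ≠ b) (hbc : b ≠ c) (hac : a ≠ c)
    (hf : ∀ i, i ≠ a → i ≠ b → i ≠ c → f i = 0) :
    ∑ i, f i = f a + f b + f c := by
  classical
  rw [← Finset.sum_subset (Finset.subset_univ {a, b, c})]
  · simp [hab, hbc, hac, add_assoc]
  · intro i _ hi
    simp only [Finset.mem_insert, Finset.mem_singleton, not_or] at hi
    exact hf i hi.1 hi.2.1 hi.2.2

/-- **Ozeki–Takeuchi identities (6.12).**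
If `S 1, …, S m` are linear endomorphisms of a real vector space `V` such that
every unit combination `S = t 1 • S 1 + ⋯ + t m • S m` (with `∑ tᵢ² = 1`)
satisfies `S ^ 3 = S`, then:
(i) `S a ^ 3 = S a` for every `a`;
(ii) `S a * S a * S b + S a * S b * S a + S b * S a * S a = S b` for `a ≠ b`;
(iii) for pairwise distinct `a, b, c` the sum of the six products of
`S a, S b, S c` in all orders vanishes. -/
theorem stmt0 {V : Type*} [AddCommGroup V] [Module ℝ V]
    (m : ℕ) (hm : 1 ≤ m) (S : Fin m → Module.End ℝ V)
    (hcube : ∀ t : Fin m → ℝ, (∑ i, t i ^ 2) = 1 →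
      (∑ i, t i • S i) ^ 3 = ∑ i, t i • S i) :
    (∀ a, S a ^ 3 = S a) ∧
    (∀ a b, a ≠ b →
      S a * S a * S b + S a * S b * S a + S b * S a * S a = S b) ∧
    (∀ a b c, a ≠ b → b ≠ c → a ≠ c →
      S a * S b * S c + S a * S c * S b + S b * S a * S c +
        S b * S c * S a + S c * S a * S b + S c * S b * S a = 0) := by
  have h_one : ∀ a, S a ^ 3 = S a := by
    intro a
    simpa [Pi.single_apply, ite_pow, ite_smul] using hcube (Pi.single a 1)
  have h_two : ∀ a b, a ≠ b →
      S a * S a * S b + S a * S b * S a + S b * S a * S a = S b := by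
    intro a b hab
    refine polarized_cube_eq_of_unit_pair (h_one a) (h_one b) fun x y hxy => ?_
    have key := hcube (fun i => if i = a then x else if i = b then y else 0)
    rw [Fintype.sum_eq_add a b hab (by rintro i ⟨ha, hb⟩; simp [ha, hb]),
      Fintype.sum_eq_add a b hab (by rintro i ⟨ha, hb⟩; simp [ha, hb])] at key
    simpa [hab.symm, hxy] using key
  refine ⟨h_one, h_two, fun a b c hab hbc hac => ?_⟩
  have key := hcube
    (fun i => if i = a then 1 / 3 else if i = b then 2 / 3 else if i = c then 2 / 3 else 0)
  rw [Fintype.sum_eq_add_add a b c hab hbc hac (by intro i ha hb hc; simp [ha, hb, hc]),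
    Fintype.sum_eq_add_add a b c hab hbc hac (by intro i ha hb hc; simp [ha, hb, hc])] at key
  simp only [if_true, if_neg hab.symm, if_neg hac.symm, if_neg hbc.symm] at key
  have h_cube := key (by norm_num)
  rw [smul_add_smul_add_smul_pow_three, h_one, h_one, h_one, h_two a b hab, h_two a c hac,
    h_two b a hab.symm, h_two b c hbc, h_two c a hac.symm, h_two c b hbc.symm] at h_cube
  linear_combination (norm := module) (27 / 4 : ℝ) • h_cube
end

section
/- Let m1, m2 be positive integers with m2 ≥ m1 + 2. For each a ∈ {1, …, m1} let A_a be an m2×m2 real matrix and B_a, C_a be m2×m1 real matrices, and assume: (i) for all a, b: B_a B_bᵀ + B_b B_aᵀ + (1/2)(A_a A_bᵀ + A_b A_aᵀ) = δ_{ab} I_{m2}; (ii) for each a, the symmetric block matrix S_a = [[0, A_a, B_a], [A_aᵀ, 0, C_a], [B_aᵀ, C_aᵀ, 0]] of size 2·m2 + m1 has rank 2·m2. Define p_a = ∑_{α,μ} (A_a)_{αμ} x_α y_μ in ℝ[x_1, …, x_{m2}, y_1, …, y_{m2}]. Then the polynomials p_1, …, p_{m1} are linearly independent over ℝ, and each p_a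 is irreducible over ℝ; moreover the same polynomials, regarded in ℂ[x_1, …, x_{m2}, y_1, …, y_{m2}], are linearly independent over ℂ and irreducible over ℂ. -/
open Matrix MvPolynomial

/-- The bilinear form `∑ M i j • x_i y_j` attached to a matrix `M`, as a polynomial. -/
noncomputable def bilinearPolynomial {m n K : Type*} [Fintype m] [Fintype n] [CommRing K]
    (M : Matrix m n K) : MvPolynomial (m ⊕ n) K :=
  ∑ i, ∑ j, MvPolynomial.C (M i j) * MvPolynomial.X (Sum.inl i) * MvPolynomial.X (Sum.inr j)

theorem bilinearPolynomial_map {m n K L : Type*} [Fintype m] [Fintype n] [CommRing K] [CommRing L]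
    (φ : K →+* L) (M : Matrix m n K) :
    MvPolynomial.map φ (bilinearPolynomial M) = bilinearPolynomial (M.map φ) := by
  simp [bilinearPolynomial]

/-- The second partial derivative of a polynomial at the origin, as a linear map. -/
noncomputable def hessianAtZero {σ K : Type*} [CommRing K] (i j : σ) :
    MvPolynomial σ K →ₗ[K] K :=
  MvPolynomial.lcoeff K 0 ∘ₗ (pderiv i).toLinearMap ∘ₗ (pderiv j).toLinearMap

theorem hessianAtZero_apply {σ K : Type*} [CommRing K] (i j : σ) (f : MvPolynomial σ K) :
    hessianAtZero i j f = constantCoeff (pderiv i (pderiv j f)) := rfl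

theorem hessianAtZero_bilinearPolynomial_inl_inr {m n K : Type*} [Fintype m] [Fintype n]
    [CommRing K] (M : Matrix m n K) (i : m) (j : n) :
    hessianAtZero (Sum.inl i) (Sum.inr j) (bilinearPolynomial M) = M i j := by
  classical
  simp [hessianAtZero_apply, bilinearPolynomial, Derivation.leibniz, pderiv_X, Pi.single_apply,
    apply_ite]

theorem hessianAtZero_bilinearPolynomial_inl_inl {m n K : Type*} [Fintype m] [Fintype n]
    [CommRing K] (M : Matrix m n K) (i j : m) :
    hessianAtZero (Sum.inl i) (Sum.inl j) (bilinearPolynomial M) = 0 := by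
  classical
  simp [hessianAtZero_apply, bilinearPolynomial, Derivation.leibniz, pderiv_X, Pi.single_apply,
    apply_ite]

theorem hessianAtZero_eq_zero_of_totalDegree_le_one {σ K : Type*} [CommRing K] (i j : σ)
    {f : MvPolynomial σ K} (hf : f.totalDegree ≤ 1) : hessianAtZero i j f = 0 := by
  rw [hessianAtZero_apply, constantCoeff_eq, coeff_pderiv, coeff_pderiv,
    coeff_eq_zero_of_totalDegree_lt, zero_mul, zero_mul]
  refine hf.trans_lt ?_
  change 1 < (0 + Finsupp.single i 1 + Finsupp.single j 1 : σ →₀ ℕ).degree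
  simp

theorem hessianAtZero_mul {σ K : Type*} [CommRing K] (i j : σ)
    {f g : MvPolynomial σ K} (hf : f.totalDegree ≤ 1) (hg : g.totalDegree ≤ 1) :
    hessianAtZero i j (f * g) =
      constantCoeff (pderiv i f) * constantCoeff (pderiv j g) +
        constantCoeff (pderiv j f) * constantCoeff (pderiv i g) := by
  have h₁ := hessianAtZero_eq_zero_of_totalDegree_le_one i j hf
  have h₂ := hessianAtZero_eq_zero_of_totalDegree_le_one i j hg
  rw [hessianAtZero_apply] at h₁ h₂ ⊢
  simp only [pderiv_mul, map_add, map_mul, h₁, h₂]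
  ring

theorem totalDegree_bilinearPolynomial_le {m n K : Type*} [Fintype m] [Fintype n] [CommRing K]
    [Nontrivial K] (M : Matrix m n K) : (bilinearPolynomial M).totalDegree ≤ 2 := by
  refine totalDegree_finsetSum_le fun i _ => totalDegree_finsetSum_le fun j _ => ?_
  refine (totalDegree_mul _ _).trans ?_
  have := totalDegree_mul (MvPolynomial.C (M i j)) (X (Sum.inl i) : MvPolynomial (m ⊕ n) K)
  simp only [totalDegree_C, totalDegree_X] at this ⊢
  lia

/-- A bilinear form of rank at least two over a field of characteristic different from two is
irreducible. -/
theorem irreducible_bilinearPolynomial {m n K : Type*} [Fintype m] [Fintype n] [Field K]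
    [NeZero (2 : K)] {M : Matrix m n K} {i k : m} {j l : n}
    (hM : M i j * M k l ≠ M i l * M k j) : Irreducible (bilinearPolynomial M) := by
  have hentry := hessianAtZero_bilinearPolynomial_inl_inr M
  have hne : ∃ r s, M r s ≠ 0 := by
    by_contra! h
    simp [h] at hM
  obtain ⟨r, s, hrs⟩ := hne
  refine ⟨fun hu => ?_, fun f g hfg => ?_⟩
  · have hdeg := (isUnit_iff_totalDegree_of_isReduced.mp hu).2
    exact hrs <| (hentry r s).symm.trans <|
      hessianAtZero_eq_zero_of_totalDegree_le_one _ _ (by lia)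
  · by_contra! hunit
    have hp : bilinearPolynomial M ≠ 0 := fun h => hrs (by simpa [h] using (hentry r s).symm)
    have hf : f ≠ 0 := by rintro rfl; simp_all
    have hg : g ≠ 0 := by rintro rfl; simp_all
    have hpos : ∀ q : MvPolynomial (m ⊕ n) K, q ≠ 0 → ¬ IsUnit q → 0 < q.totalDegree := by
      intro q hq hq'
      by_contra! h
      have hC := totalDegree_eq_zero_iff_eq_C.mp (Nat.le_zero.mp h)
      refine hq' (isUnit_iff_eq_C_of_isReduced.mpr ⟨_, ?_, hC⟩)
      exact isUnit_iff_ne_zero.mpr fun h0 => hq (by rw [hC, h0, C_0])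
    have hdeg := totalDegree_bilinearPolynomial_le M
    rw [hfg, totalDegree_mul_of_isDomain hf hg] at hdeg
    have hf₀ := hpos f hf hunit.1
    have hg₀ := hpos g hg hunit.2
    have hmul (a b) := hessianAtZero_mul a b (f := f) (g := g) (by lia) (by lia)
    simp only [← hfg] at hmul
    set u := fun a => constantCoeff (pderiv a f)
    set v := fun a => constantCoeff (pderiv a g)
    have hM' (a b) : M a b = u (.inl a) * v (.inr b) + u (.inr b) * v (.inl a) := by
      rw [← hentry, hmul]
    have hxx (a b) : u (.inl a) * v (.inl b) + u (.inl b) * v (.inl a) = 0 := by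
      rw [← hmul, hessianAtZero_bilinearPolynomial_inl_inl]
    by_cases hu : ∀ a, u (.inl a) = 0
    · apply hM
      simp only [hM', hu]
      ring
    · push Not at hu
      obtain ⟨a, ha⟩ := hu
      have hva : v (.inl a) = 0 := by
        have h2 : (2 : K) * (u (.inl a) * v (.inl a)) = 0 := by linear_combination hxx a a
        simpa [ha, NeZero.ne] using h2
      have hv (b) : v (.inl b) = 0 := by simpa [hva, ha] using hxx a b
      apply hM
      simp only [hM', hv]
      ring

theorem Matrix.exists_eq_vecMulVec_of_minors_eq_zero {m n K : Type*} [Field K] {M : Matrix m n K}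
    (hM : ∀ i k j l, M i j * M k l = M i l * M k j) : ∃ u v, M = vecMulVec u v := by
  by_cases h : ∃ r s, M r s ≠ 0
  · obtain ⟨r, s, hrs⟩ := h
    refine ⟨fun i => M i s / M r s, M r, ?_⟩
    ext i j
    rw [vecMulVec_apply, div_mul_eq_mul_div, eq_div_iff hrs]
    exact hM i r j s
  · push Not at h
    exact ⟨0, 0, by ext i j; simp [h]⟩

theorem Matrix.exists_minor_ne_zero {m n : Type*} [Fintype m] [Fintype n] [DecidableEq m]
    (hcard : Fintype.card n + 2 ≤ Fintype.card m) {M : Matrix m m ℝ} {N : Matrix m n ℝ} {s : ℝ}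
    (hs : s ≠ 0) (h : (2 : ℝ) • (N * Nᵀ) + M * Mᵀ = s • 1) :
    ∃ i k j l, M i j * M k l ≠ M i l * M k j := by
  by_contra! hM
  obtain ⟨u, v, huv⟩ := exists_eq_vecMulVec_of_minors_eq_zero hM
  have hfac : (1 : Matrix m m ℝ) =
      fromCols N (replicateCol Unit u) *
        (s⁻¹ • fromRows ((2 : ℝ) • Nᵀ) (replicateRow Unit v * Mᵀ)) := by
    rw [Matrix.mul_smul, fromCols_mul_fromRows, Matrix.mul_smul, ← Matrix.mul_assoc,
      ← vecMulVec_eq, ← huv, h, inv_smul_smul₀ hs]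
  have hrank : Fintype.card m ≤ Fintype.card (n ⊕ Unit) := by
    conv_lhs => rw [← rank_one (R := ℝ) (n := m), hfac]
    exact (rank_mul_le_left _ _).trans (rank_le_card_width _)
  simp only [Fintype.card_sum, Fintype.card_unit] at hrank
  lia

theorem Matrix.two_smul_sum_smul_mul_transpose {ι m n : Type*} [Fintype ι] [Fintype n]
    (D : ι → Matrix m n ℝ) (c : ι → ℝ) :
    (2 : ℝ) • ((∑ a, c a • D a) * (∑ a, c a • D a)ᵀ) =
      ∑ a, ∑ b, (c a * c b) • (D a * (D b)ᵀ + D b * (D a)ᵀ) := by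
  have hr : ∑ a, ∑ b, (c a * c b) • (D b * (D a)ᵀ) = ∑ a, ∑ b, (c a * c b) • (D a * (D b)ᵀ) := by
    rw [Finset.sum_comm]
    exact Finset.sum_congr rfl fun a _ => Finset.sum_congr rfl fun b _ => by rw [mul_comm (c b)]
  have hl : (∑ a, c a • D a) * (∑ a, c a • D a)ᵀ = ∑ a, ∑ b, (c a * c b) • (D a * (D b)ᵀ) := by
    simp only [← hr, transpose_sum, transpose_smul, Matrix.sum_mul, Matrix.mul_sum,
      Matrix.smul_mul, Matrix.mul_smul, Finset.smul_sum, smul_smul]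
  simp only [smul_add, Finset.sum_add_distrib, hr, hl, two_smul]

/-- Polarization: orthonormality of the symmetrized products on a family passes to its linear
combinations. -/
theorem Matrix.sum_smul_mul_transpose_eq {ι m n : Type*} [Fintype ι] [Fintype m] [Fintype n]
    [DecidableEq ι] [DecidableEq m] {A : ι → Matrix m m ℝ} {B : ι → Matrix m n ℝ}
    (h : ∀ a b, B a * (B b)ᵀ + B b * (B a)ᵀ +
      (1 / 2 : ℝ) • (A a * (A b)ᵀ + A b * (A a)ᵀ) = if a = b then (1 : Matrix m m ℝ) else 0)
    (c : ι → ℝ) :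
    (2 : ℝ) • ((∑ a, c a • B a) * (∑ a, c a • B a)ᵀ) + (∑ a, c a • A a) * (∑ a, c a • A a)ᵀ =
      (∑ a, c a ^ 2) • (1 : Matrix m m ℝ) := by
  have hA : (∑ a, c a • A a) * (∑ a, c a • A a)ᵀ =
      (1 / 2 : ℝ) • ∑ a, ∑ b, (c a * c b) • (A a * (A b)ᵀ + A b * (A a)ᵀ) := by
    rw [← two_smul_sum_smul_mul_transpose, smul_smul]
    norm_num
  calc _ = ∑ a, ∑ b, (c a * c b) • (B a * (B b)ᵀ + B b * (B a)ᵀ +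
        (1 / 2 : ℝ) • (A a * (A b)ᵀ + A b * (A a)ᵀ)) := by
        rw [two_smul_sum_smul_mul_transpose, hA]
        simp only [smul_add, Finset.sum_add_distrib, Finset.smul_sum, smul_comm (1 / 2 : ℝ)]
    _ = _ := by
        simp only [h]
        simp [Finset.sum_smul, sq]

theorem linearIndependent_bilinearPolynomial {ι m n K : Type*} [Fintype m] [Fintype n] [CommRing K]
    {M : ι → Matrix m n K} (hM : LinearIndependent K fun a (x : m × n) => M a x.1 x.2) :
    LinearIndependent K fun a => bilinearPolynomial (M a) := by
  refine .of_comp (LinearMap.pi fun x : m × n => hessianAtZero (Sum.inl x.1) (Sum.inr x.2)) ?_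
  have hcomp : (LinearMap.pi fun x : m × n => hessianAtZero (Sum.inl x.1) (Sum.inr x.2)) ∘
      (fun a => bilinearPolynomial (M a)) = fun a (x : m × n) => M a x.1 x.2 := by
    ext a x
    exact hessianAtZero_bilinearPolynomial_inl_inr _ _ _
  exact hcomp ▸ hM

/-- **Lemma 9.1.**
Let `m2 ≥ m1 + 2`.  Assume the matrices `A a` (size `m2×m2`) and `B a, C a`
(size `m2×m1`) satisfy the identity (i) (the second equation of (5.6)) and that
each symmetric block matrix `S a = [[0, A a, B a],[A aᵀ, 0, C a],[B aᵀ, C aᵀ, 0]]`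
has rank `2·m2`.  Then the quadratic forms `p a = ∑ (A a)_{αμ} x_α y_μ` are
linearly independent and irreducible over `ℝ`, and their complexifications are
linearly independent and irreducible over `ℂ`. -/
theorem stmt9 (m1 m2 : ℕ) (hm1 : 0 < m1) (hm2 : 0 < m2) (hm : m1 + 2 ≤ m2)
    (A : Fin m1 → Matrix (Fin m2) (Fin m2) ℝ)
    (B C : Fin m1 → Matrix (Fin m2) (Fin m1) ℝ)
    (hi : ∀ a b, B a * (B b)ᵀ + B b * (B a)ᵀ +
      (1 / 2 : ℝ) • (A a * (A b)ᵀ + A b * (A a)ᵀ) =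
      if a = b then (1 : Matrix (Fin m2) (Fin m2) ℝ) else 0)
    (S : Fin m1 → Matrix (Fin m2 ⊕ (Fin m2 ⊕ Fin m1)) (Fin m2 ⊕ (Fin m2 ⊕ Fin m1)) ℝ)
    (hS : ∀ a, S a = Matrix.of fun i j =>
      match i, j with
      | Sum.inl i, Sum.inl _ => (0 : ℝ)
      | Sum.inl i, Sum.inr (Sum.inl j) => A a i j
      | Sum.inl i, Sum.inr (Sum.inr j) => B a i j
      | Sum.inr (Sum.inl i), Sum.inl j => (A a)ᵀ i j
      | Sum.inr (Sum.inl i), Sum.inr (Sum.inl j) => (0 : ℝ)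
      | Sum.inr (Sum.inl i), Sum.inr (Sum.inr j) => C a i j
      | Sum.inr (Sum.inr i), Sum.inl j => (B a)ᵀ i j
      | Sum.inr (Sum.inr i), Sum.inr (Sum.inl j) => (C a)ᵀ i j
      | Sum.inr (Sum.inr i), Sum.inr (Sum.inr j) => (0 : ℝ))
    (hrank : ∀ a, (S a).rank = 2 * m2)
    (p : Fin m1 → MvPolynomial (Fin m2 ⊕ Fin m2) ℝ)
    (hp : ∀ a, p a = ∑ α : Fin m2, ∑ μ : Fin m2,
      MvPolynomial.C (A a α μ) * MvPolynomial.X (Sum.inl α) * MvPolynomial.X (Sum.inr μ)) :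
    LinearIndependent ℝ p ∧
    (∀ a, Irreducible (p a)) ∧
    LinearIndependent ℂ (fun a => MvPolynomial.map (algebraMap ℝ ℂ) (p a)) ∧
    (∀ a, Irreducible (MvPolynomial.map (algebraMap ℝ ℂ) (p a))) := by
  have hminor (c : Fin m1 → ℝ) (hc : c ≠ 0) : ∃ i k j l,
      (∑ a, c a • A a) i j * (∑ a, c a • A a) k l ≠
        (∑ a, c a • A a) i l * (∑ a, c a • A a) k j := by
    refine Matrix.exists_minor_ne_zero (by simpa using hm) ?_
      (Matrix.sum_smul_mul_transpose_eq hi c)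
    contrapose! hc
    ext a
    have := (Finset.sum_eq_zero_iff_of_nonneg fun a _ => sq_nonneg (c a)).mp hc a
    simpa using this
  have hminor' (a : Fin m1) : ∃ i k j l, A a i j * A a k l ≠ A a i l * A a k j := by
    simpa [Pi.single_apply] using hminor (Pi.single a 1) (by simp)
  have hli : LinearIndependent ℝ fun a (x : Fin m2 × Fin m2) => A a x.1 x.2 := by
    rw [Fintype.linearIndependent_iff]
    intro c hc
    by_contra! hne
    obtain ⟨i, k, j, l, h⟩ := hminor c fun h => by simp [h] at hne
    have hzero : ∑ a, c a • A a = 0 := by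
      ext i j
      simpa [Matrix.sum_apply] using congrFun hc (i, j)
    simp [hzero] at h
  obtain rfl : p = fun a => bilinearPolynomial (A a) := funext hp
  simp only [bilinearPolynomial_map]
  refine ⟨linearIndependent_bilinearPolynomial hli, fun a => ?_,
    linearIndependent_bilinearPolynomial (linearIndependent_algebraMap_comp_iff.mpr hli),
    fun a => ?_⟩
  · obtain ⟨i, k, j, l, h⟩ := hminor' a
    exact irreducible_bilinearPolynomial h
  · obtain ⟨i, k, j, l, h⟩ := hminor' a
    refine irreducible_bilinearPolynomial (i := i) (k := k) (j := j) (l := l) ?_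
    simpa only [Matrix.map_apply, ← map_mul, ne_eq, (algebraMap ℝ ℂ).injective.eq_iff] using h
end
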